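/- Let β > 0 be sufficiently small and let Ω ⊂ ℝ² be a convex body with |Ω △ B₁(0)| ≤ β. Let u(x) := d(x, ∂Ω); since u is concave, ∇u is a function of bounded variation, and let V(∇u, A) denote the total variation of the measure D(∇u) on a set A. Then there exists a universal constant c such that: (i) V(∇u, Ω\B_{3β^{1/8}}(0)) ≤ c; and (ii) for every ϱ ∈ (0, β^{1/2}] and every x ∈ Ω\(N_{2ϱ}(∂Ω) ∪ B_{4β^{1/8}}(0)), V(∇u, B_ϱ(x)) ≤ c·β^{3/16}·ϱ. -/

import Mathlib

open MeasureTheory Metric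
open scoped RealInnerProductSpace ENNReal

noncomputable section

abbrev E2 := EuclideanSpace ℝ (Fin 2)

/-- Divergence of a planar vector field. -/
def divg (F : E2 → E2) (x : E2) : ℝ :=
  ∑ j : Fin 2, fderiv ℝ F x (EuclideanSpace.single j 1) j

/-- The total variation `|Dv|(A)` of (the distributional derivative of) a vector field
`v : ℝ² → ℝ²` on a set `A`, defined by duality against smooth compactly supported test fields
of norm at most `1`. -/
def totalVar (v : E2 → E2) (A : Set E2) : ℝ :=
  sSup {t : ℝ | ∃ φ : Fin 2 → E2 → E2,
    (∀ i, ContDiff ℝ (⊤ : ℕ∞) (φ i)) ∧ (∀ i, HasCompactSupport (φ i)) ∧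
    (∀ i, tsupport (φ i) ⊆ A) ∧ (∀ x, (∑ i : Fin 2, ‖φ i x‖ ^ 2) ≤ 1) ∧
    t = ∑ i : Fin 2, ∫ x in A, v x i * divg (φ i) x}

open Set Filter Topology
open scoped NNReal ContDiff

/-- The distributional Hessian of `w` in the directions `a`, `b`, tested against `f`. -/
def hessPairing (w f : E2 → ℝ) (a b : E2) : ℝ :=
  ∫ x, w x * fderiv ℝ (fderiv ℝ f) x a b

lemma contDiff_fderiv_apply {f : E2 → ℝ} (hf : ContDiff ℝ ∞ f) (b : E2) :
    ContDiff ℝ ∞ fun x => fderiv ℝ f x b :=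
  (hf.fderiv_right (m := ∞) (by simp)).clm_apply contDiff_const

lemma hasCompactSupport_fderiv_apply {f : E2 → ℝ} (hfc : HasCompactSupport f) (b : E2) :
    HasCompactSupport fun x => fderiv ℝ f x b :=
  hfc.fderiv_apply (𝕜 := ℝ) b

lemma fderiv_fderiv_apply {f : E2 → ℝ} (hf : ContDiff ℝ ∞ f) (a b x : E2) :
    fderiv ℝ (fun y => fderiv ℝ f y b) x a = fderiv ℝ (fderiv ℝ f) x a b := by
  have h : DifferentiableAt ℝ (fderiv ℝ f) x :=
    (hf.fderiv_right (m := ∞) (by simp)).differentiable (by simp) x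
  have := h.hasFDerivAt.clm_apply (hasFDerivAt_const b x)
  rw [this.fderiv]
  simp

lemma fderiv_fderiv_comm {f : E2 → ℝ} (hf : ContDiff ℝ ∞ f) (a b x : E2) :
    fderiv ℝ (fderiv ℝ f) x a b = fderiv ℝ (fderiv ℝ f) x b a :=
  (hf.contDiffAt.isSymmSndFDerivAt (by simpa using ENat.LEInfty.out)) a b

lemma integrable_mul_fderiv_fderiv {w f : E2 → ℝ} (hw : Continuous w) (hf : ContDiff ℝ ∞ f)
    (hfc : HasCompactSupport f) (a b : E2) :
    Integrable fun x => w x * fderiv ℝ (fderiv ℝ f) x a b := by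
  simp_rw [← fderiv_fderiv_apply hf]
  have h1 := contDiff_fderiv_apply (contDiff_fderiv_apply hf b) a
  have h2 := hasCompactSupport_fderiv_apply (hasCompactSupport_fderiv_apply hfc b) a
  exact (hw.mul h1.continuous).integrable_of_hasCompactSupport h2.mul_left

/-- Integration by parts of a Lipschitz function against a first derivative of a test function. -/
lemma integral_lineDeriv_mul_fderiv {w f : E2 → ℝ} {C : ℝ≥0} (hw : LipschitzWith C w)
    (hf : ContDiff ℝ ∞ f) (hfc : HasCompactSupport f) (a b : E2) :
    ∫ x, lineDeriv ℝ w x a * fderiv ℝ f x b = - hessPairing w f a b := by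
  have h1 := contDiff_fderiv_apply hf b
  have h2 := hasCompactSupport_fderiv_apply hfc b
  obtain ⟨D, hD⟩ := ContDiff.lipschitzWith_of_hasCompactSupport h2 h1 (by simp)
  rw [hw.integral_lineDeriv_mul_eq hD h2 a, hessPairing, ← integral_neg]
  refine integral_congr_ae (.of_forall fun x => ?_)
  have h3 : DifferentiableAt ℝ (fun y => fderiv ℝ f y b) x := h1.differentiable (by simp) x
  simp only [h3.lineDeriv_eq_fderiv, map_neg, fderiv_fderiv_apply hf,
    neg_apply]
  ring

lemma ConcaveOn.antitone_sub_translate {g : ℝ → ℝ} (hg : ConcaveOn ℝ univ g) {t : ℝ}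
    (ht : 0 ≤ t) : Antitone fun s => g (s + t) - g s := by
  intro s₁ s₂ h
  rcases ht.eq_or_lt with rfl | ht
  · simp
  set L := s₂ + t - s₁ with hL
  have hLpos : 0 < L := by linarith
  have hg2 := hg.2
  have e1 := hg2 (mem_univ s₁) (mem_univ (s₂ + t)) (a := t / L) (b := (s₂ - s₁) / L)
    (by positivity) (div_nonneg (by linarith) hLpos.le) (by field_simp; linarith)
  have e2 := hg2 (mem_univ s₁) (mem_univ (s₂ + t)) (a := (s₂ - s₁) / L) (b := t / L)
    (div_nonneg (by linarith) hLpos.le) (by positivity) (by field_simp; linarith)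
  have p1 : (t / L) • s₁ + ((s₂ - s₁) / L) • (s₂ + t) = s₂ := by
    simp only [smul_eq_mul]; field_simp; rw [hL]; ring
  have p2 : ((s₂ - s₁) / L) • s₁ + (t / L) • (s₂ + t) = s₁ + t := by
    simp only [smul_eq_mul]; field_simp; rw [hL]; ring
  rw [p1] at e1
  rw [p2] at e2
  have hsum : t / L + (s₂ - s₁) / L = 1 := by field_simp; linarith
  simp only [smul_eq_mul] at e1 e2
  have : (t / L + (s₂ - s₁) / L) * (g s₁ + g (s₂ + t)) = g s₁ + g (s₂ + t) := by
    rw [hsum, one_mul]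
  show g (s₂ + t) - g s₂ ≤ g (s₁ + t) - g s₁
  nlinarith

lemma ConcaveOn.lineDeriv_sub_translate_nonpos {w : E2 → ℝ} (hw : ConcaveOn ℝ univ w) {t : ℝ}
    (ht : 0 < t) (x e : E2) :
    lineDeriv ℝ (fun y => t⁻¹ • (w (y + t • e) - w y)) x e ≤ 0 := by
  have hg : ConcaveOn ℝ univ fun s : ℝ => w (x + s • e) := by
    refine ⟨convex_univ, fun s _ r _ a b ha hb hab => ?_⟩
    have := hw.2 (mem_univ (x + s • e)) (mem_univ (x + r • e)) ha hb hab
    convert this using 2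
    have hx : x = (a + b) • x := by rw [hab, one_smul]
    nth_rw 1 [hx]
    simp only [smul_eq_mul]
    module
  have h1 : Antitone fun s : ℝ => t⁻¹ • (w (x + s • e + t • e) - w (x + s • e)) := by
    have h := hg.antitone_sub_translate ht.le
    intro s₁ s₂ h12
    have := h h12
    simp only [add_smul, ← add_assoc] at this
    exact smul_le_smul_of_nonneg_left this (by positivity)
  exact h1.deriv_nonpos

/-- The distributional Hessian of a concave function is nonpositive. -/
lemma ConcaveOn.hessPairing_nonpos {w f : E2 → ℝ} {C : ℝ≥0} (hw : ConcaveOn ℝ univ w)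
    (hwL : LipschitzWith C w) (hf : ContDiff ℝ ∞ f) (hfc : HasCompactSupport f)
    (hf0 : ∀ x, 0 ≤ f x) (e : E2) : hessPairing w f e e ≤ 0 := by
  have h1 := contDiff_fderiv_apply hf e
  have h2 := hasCompactSupport_fderiv_apply hfc e
  have hint : Integrable (fun x => fderiv ℝ f x e) :=
    h1.continuous.integrable_of_hasCompactSupport h2
  have hlim := hwL.integral_inv_smul_sub_mul_tendsto_integral_lineDeriv_mul (μ := volume) hint e
  rw [integral_lineDeriv_mul_fderiv hwL hf hfc e e] at hlim
  rw [← neg_nonneg]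
  refine ge_of_tendsto hlim ?_
  filter_upwards [self_mem_nhdsWithin] with t ht
  have ht : 0 < t := ht
  have hshift : LipschitzWith C fun y => w (y + t • e) := by
    refine LipschitzWith.of_dist_le_mul fun y z => ?_
    simpa using hwL.dist_le_mul (y + t • e) (z + t • e)
  have hW : LipschitzWith (‖t⁻¹‖₊ * (C + C)) fun y => t⁻¹ • (w (y + t • e) - w y) :=
    (lipschitzWith_smul t⁻¹).comp (hshift.sub hwL)
  obtain ⟨D, hD⟩ := ContDiff.lipschitzWith_of_hasCompactSupport hfc hf (by simp)
  have key := hW.integral_lineDeriv_mul_eq (μ := volume) hD hfc e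
  have hle : ∫ x, lineDeriv ℝ (fun y => t⁻¹ • (w (y + t • e) - w y)) x e * f x ≤ 0 :=
    integral_nonpos fun x =>
      mul_nonpos_of_nonpos_of_nonneg (hw.lineDeriv_sub_translate_nonpos ht x e) (hf0 x)
  rw [key] at hle
  have : ∫ x, lineDeriv ℝ f x (-e) * t⁻¹ • (w (x + t • e) - w x) =
      - ∫ x, t⁻¹ • (w (x + t • e) - w x) * fderiv ℝ f x e := by
    rw [← integral_neg]
    refine integral_congr_ae (.of_forall fun x => ?_)
    have h3 : DifferentiableAt ℝ f x := hf.differentiable (by simp) x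
    simp only [h3.lineDeriv_eq_fderiv, map_neg, smul_eq_mul]
    ring
  rw [this] at hle
  linarith

lemma hessPairing_sub {w f g : E2 → ℝ} (hw : Continuous w) (hf : ContDiff ℝ ∞ f)
    (hfc : HasCompactSupport f) (hg : ContDiff ℝ ∞ g) (hgc : HasCompactSupport g) (a b : E2) :
    hessPairing w (f - g) a b = hessPairing w f a b - hessPairing w g a b := by
  rw [hessPairing, hessPairing, hessPairing, ← integral_sub
    (integrable_mul_fderiv_fderiv hw hf hfc a b) (integrable_mul_fderiv_fderiv hw hg hgc a b)]
  refine integral_congr_ae (.of_forall fun x => ?_)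
  have h1 : fderiv ℝ (f - g) = fderiv ℝ f - fderiv ℝ g := by
    ext1 y
    exact fderiv_sub (hf.differentiable (by simp) y) (hg.differentiable (by simp) y)
  have h2 : fderiv ℝ (fderiv ℝ f - fderiv ℝ g) x =
      fderiv ℝ (fderiv ℝ f) x - fderiv ℝ (fderiv ℝ g) x :=
    fderiv_sub ((hf.fderiv_right (m := ∞) (by simp)).differentiable (by simp) x)
      ((hg.fderiv_right (m := ∞) (by simp)).differentiable (by simp) x)
  simp only [h1, h2, sub_apply]
  ring

lemma hessPairing_polarization {w f : E2 → ℝ} (hw : Continuous w) (hf : ContDiff ℝ ∞ f)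
    (hfc : HasCompactSupport f) (a b : E2) :
    4 * hessPairing w f a b =
      hessPairing w f (a + b) (a + b) - hessPairing w f (a - b) (a - b) := by
  rw [hessPairing, hessPairing, hessPairing, ← integral_sub
    (integrable_mul_fderiv_fderiv hw hf hfc _ _) (integrable_mul_fderiv_fderiv hw hf hfc _ _),
    ← integral_const_mul]
  refine integral_congr_ae (.of_forall fun x => ?_)
  simp only [map_add, map_sub, add_apply, sub_apply,
    fderiv_fderiv_comm hf b a x]
  ring

lemma hessPairing_parallelogram {w f : E2 → ℝ} (hw : Continuous w) (hf : ContDiff ℝ ∞ f)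
    (hfc : HasCompactSupport f) (a b : E2) :
    hessPairing w f (a + b) (a + b) + hessPairing w f (a - b) (a - b) =
      2 * (hessPairing w f a a + hessPairing w f b b) := by
  simp only [hessPairing]
  rw [← integral_add
    (integrable_mul_fderiv_fderiv hw hf hfc _ _) (integrable_mul_fderiv_fderiv hw hf hfc _ _),
    ← integral_add
    (integrable_mul_fderiv_fderiv hw hf hfc _ _) (integrable_mul_fderiv_fderiv hw hf hfc _ _),
    ← integral_const_mul]
  refine integral_congr_ae (.of_forall fun x => ?_)
  simp only [map_add, map_sub, add_apply, sub_apply,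
    fderiv_fderiv_comm hf b a x]
  ring

lemma ConcaveOn.hessPairing_anti {w f g : E2 → ℝ} {C : ℝ≥0} (hw : ConcaveOn ℝ univ w)
    (hwL : LipschitzWith C w) (hf : ContDiff ℝ ∞ f) (hfc : HasCompactSupport f)
    (hg : ContDiff ℝ ∞ g) (hgc : HasCompactSupport g) (hfg : ∀ x, f x ≤ g x) (e : E2) :
    hessPairing w g e e ≤ hessPairing w f e e := by
  have h := hw.hessPairing_nonpos hwL (hg.sub hf) (hgc.sub hfc)
    (fun x => sub_nonneg.2 (hfg x)) e
  have h' := hessPairing_sub hwL.continuous hg hgc hf hfc e e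
  change hessPairing w (g - f) e e ≤ 0 at h
  linarith

/-- The mixed entries of the Hessian of a concave function are controlled by its diagonal. -/
lemma ConcaveOn.neg_hessPairing_le {w f g : E2 → ℝ} {C : ℝ≥0} (hw : ConcaveOn ℝ univ w)
    (hwL : LipschitzWith C w) (hf : ContDiff ℝ ∞ f) (hfc : HasCompactSupport f)
    (hg : ContDiff ℝ ∞ g) (hgc : HasCompactSupport g) (hfg : ∀ x, |f x| ≤ g x) (a b : E2) :
    - hessPairing w f a b ≤ (- hessPairing w g a a - hessPairing w g b b) / 2 := by
  have hw' := hwL.continuous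
  have h1 := hw.hessPairing_anti hwL hf hfc hg hgc (fun x => (le_abs_self _).trans (hfg x)) (a + b)
  have h2 := hw.hessPairing_anti hwL (hg.neg) hgc.neg hf hfc
    (fun x => neg_le.1 ((neg_le_abs _).trans (hfg x))) (a - b)
  have h3 : hessPairing w (fun x => - g x) (a - b) (a - b) = - hessPairing w g (a - b) (a - b) := by
    have h := hessPairing_sub hw' (f := fun _ => (0 : ℝ)) contDiff_const HasCompactSupport.zero
      hg hgc (a - b) (a - b)
    have h0 : hessPairing w (fun _ => (0 : ℝ)) (a - b) (a - b) = 0 := by simp [hessPairing]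
    rw [h0, zero_sub] at h
    rw [← h]
    congr 1
    ext x
    simp
  have h4 := hessPairing_polarization hw' hf hfc a b
  have h5 := hessPairing_parallelogram hw' hg hgc a b
  linarith

lemma gradient_apply_eq_lineDeriv {w : E2 → ℝ} {x : E2} (h : DifferentiableAt ℝ w x)
    (i : Fin 2) : gradient w x i = lineDeriv ℝ w x (EuclideanSpace.single i 1) := by
  have h1 : inner ℝ (gradient w x) (EuclideanSpace.single i (1 : ℝ)) = gradient w x i := by
    rw [EuclideanSpace.inner_single_right]
    simp
  rw [h.lineDeriv_eq_fderiv, ← h1, gradient, InnerProductSpace.toDual_symm_apply]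

lemma contDiff_coord {F : E2 → E2} (hF : ContDiff ℝ ∞ F) (j : Fin 2) :
    ContDiff ℝ ∞ fun x => F x j :=
  (contDiff_euclidean.1 hF) j

lemma hasCompactSupport_coord {F : E2 → E2} (hF : HasCompactSupport F) (j : Fin 2) :
    HasCompactSupport fun x => F x j :=
  hF.comp_left (g := fun y : E2 => y j) rfl

lemma divg_eq_sum_fderiv_coord {F : E2 → E2} (hF : ContDiff ℝ ∞ F) (x : E2) :
    divg F x = ∑ j : Fin 2, fderiv ℝ (fun y => F y j) x (EuclideanSpace.single j 1) := by
  refine Finset.sum_congr rfl fun j _ => ?_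
  have h : HasFDerivAt (fun y => F y j) ((EuclideanSpace.proj j : E2 →L[ℝ] ℝ) ∘L fderiv ℝ F x) x :=
    (EuclideanSpace.proj j : E2 →L[ℝ] ℝ).hasFDerivAt.comp x
      (hF.differentiable (by simp) x).hasFDerivAt
  rw [h.fderiv]
  rfl

lemma integrable_lineDeriv_mul {w g : E2 → ℝ} {C : ℝ≥0} (hw : LipschitzWith C w)
    (hg : Continuous g) (hgc : HasCompactSupport g) (a : E2) :
    Integrable fun x => lineDeriv ℝ w x a * g x :=
  (hg.integrable_of_hasCompactSupport hgc).bdd_mul (c := C * ‖a‖)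
    (aestronglyMeasurable_lineDeriv hw.continuous _)
    (.of_forall fun _ => norm_lineDeriv_le_of_lipschitz ℝ hw)

lemma integral_gradient_mul_divg {w : E2 → ℝ} {C : ℝ≥0} (hw : LipschitzWith C w)
    {F : E2 → E2} (hF : ContDiff ℝ ∞ F) (hFc : HasCompactSupport F) (i : Fin 2) :
    ∫ x, gradient w x i * divg F x = ∑ j : Fin 2, - hessPairing w (fun x => F x j)
      (EuclideanSpace.single i 1) (EuclideanSpace.single j 1) := by
  have h1 : ∫ x, gradient w x i * divg F x = ∫ x, ∑ j : Fin 2,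
      lineDeriv ℝ w x (EuclideanSpace.single i 1) *
        fderiv ℝ (fun y => F y j) x (EuclideanSpace.single j 1) := by
    refine integral_congr_ae ?_
    filter_upwards [hw.ae_differentiableAt] with x hx
    rw [gradient_apply_eq_lineDeriv hx, divg_eq_sum_fderiv_coord hF, Finset.mul_sum]
  rw [h1, integral_finsetSum]
  · exact Finset.sum_congr rfl fun j _ => integral_lineDeriv_mul_fderiv hw (contDiff_coord hF j)
      (hasCompactSupport_coord hFc j) _ _
  · intro j _
    exact integrable_lineDeriv_mul hw
      (contDiff_fderiv_apply (contDiff_coord hF j) _).continuous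
      (hasCompactSupport_fderiv_apply (hasCompactSupport_coord hFc j) _) _

/-- The total variation of the gradient of a concave function is controlled by its Laplacian. -/
lemma ConcaveOn.sum_integral_gradient_mul_divg_le {w η : E2 → ℝ} {C : ℝ≥0}
    (hw : ConcaveOn ℝ univ w) (hwL : LipschitzWith C w) {φ : Fin 2 → E2 → E2}
    (hφ : ∀ i, ContDiff ℝ ∞ (φ i)) (hφc : ∀ i, HasCompactSupport (φ i))
    (hη : ContDiff ℝ ∞ η) (hηc : HasCompactSupport η) (hφη : ∀ i x j, |φ i x j| ≤ η x) :
    ∑ i : Fin 2, ∫ x, gradient w x i * divg (φ i) x ≤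
      2 * ∑ i : Fin 2, - hessPairing w η (EuclideanSpace.single i 1) (EuclideanSpace.single i 1) := by
  have key := fun i j : Fin 2 => hw.neg_hessPairing_le hwL (contDiff_coord (hφ i) j)
    (hasCompactSupport_coord (hφc i) j) hη hηc (fun x => hφη i x j)
    (EuclideanSpace.single i 1) (EuclideanSpace.single j 1)
  simp only [integral_gradient_mul_divg hwL (hφ _) (hφc _), Fin.sum_univ_two]
  have h00 := key 0 0
  have h01 := key 0 1
  have h10 := key 1 0
  have h11 := key 1 1
  linarith

lemma neg_hessPairing_le_of_gradient_near {w η : E2 → ℝ} {C D : ℝ≥0} (hw : LipschitzWith C w)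
    (hη : ContDiff ℝ ∞ η) (hηc : HasCompactSupport η) (hηL : LipschitzWith D η) {x ν : E2}
    {r κ : ℝ} (hr : 0 ≤ r) (hηs : tsupport η ⊆ closedBall x r)
    (hκ : ∀ y ∈ closedBall x r, DifferentiableAt ℝ w y → ‖gradient w y - ν‖ ≤ κ) (i : Fin 2) :
    - hessPairing w η (EuclideanSpace.single i 1) (EuclideanSpace.single i 1) ≤
      κ * D * (Real.pi * r ^ 2) := by
  set e : E2 := EuclideanSpace.single i 1 with he
  have hne : ‖e‖ = 1 := by simp [he]
  have hd := contDiff_fderiv_apply hη e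
  have hdc := hasCompactSupport_fderiv_apply hηc e
  have hzero : ∫ y, ν i * fderiv ℝ η y e = 0 := by
    have h := (LipschitzWith.const (ν i : ℝ) (α := E2)).integral_lineDeriv_mul_eq
      (μ := volume) hηL hηc e
    have h' : ∀ y, lineDeriv ℝ η y (-e) * ν i = - (ν i * fderiv ℝ η y e) := fun y => by
      rw [(hη.differentiable (by simp) y).lineDeriv_eq_fderiv, map_neg]
      ring
    have h0 : ∀ y : E2, lineDeriv ℝ (fun _ : E2 => ν i) y e = 0 := fun y => by simp [lineDeriv]
    simp only [h0, zero_mul, integral_zero, h', integral_neg] at h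
    linarith
  have hvol : volume.real (closedBall x r) = Real.pi * r ^ 2 := by
    rw [Measure.real, EuclideanSpace.volume_closedBall_fin_two]
    simp [hr, Real.pi_pos.le, mul_comm]
  rw [← integral_lineDeriv_mul_fderiv hw hη hηc, ← sub_zero (∫ _, _), ← hzero, ← integral_sub
    (integrable_lineDeriv_mul hw hd.continuous hdc e)
    ((hd.continuous.integrable_of_hasCompactSupport hdc).const_mul _), ← hvol]
  have hsupp : ∀ y, y ∉ closedBall x r →
      lineDeriv ℝ w y e * fderiv ℝ η y e - ν i * fderiv ℝ η y e = 0 := fun y hy => by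
    have : fderiv ℝ η y = 0 := fderiv_of_notMem_tsupport (𝕜 := ℝ) fun h => hy (hηs h)
    simp [this]
  rw [← setIntegral_eq_integral_of_forall_compl_eq_zero hsupp]
  refine (le_abs_self _).trans ?_
  rw [← Real.norm_eq_abs]
  refine norm_setIntegral_le_of_norm_le_const_ae' (isCompact_closedBall x r).measure_lt_top ?_
  filter_upwards [hw.ae_differentiableAt] with y hy hyb
  rw [← sub_mul, norm_mul, ← gradient_apply_eq_lineDeriv hy i]
  have h1 : ‖gradient w y i - ν i‖ ≤ κ :=
    (PiLp.norm_apply_le (gradient w y - ν) i).trans (hκ y hyb hy)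
  have h2 : ‖fderiv ℝ η y e‖ ≤ D := by
    refine ((fderiv ℝ η y).le_opNorm e).trans ?_
    rw [hne, mul_one]
    exact norm_fderiv_le_of_lipschitz ℝ hηL
  exact mul_le_mul h1 h2 (norm_nonneg _) ((norm_nonneg _).trans h1)

lemma exists_smooth_cutoff : ∃ D : ℝ≥0, ∀ (x : E2) (r : ℝ), 0 < r → ∃ η : E2 → ℝ,
    ContDiff ℝ ∞ η ∧ HasCompactSupport η ∧ LipschitzWith (D * r⁻¹.toNNReal) η ∧
      tsupport η ⊆ closedBall x (2 * r) ∧ (∀ y, 0 ≤ η y) ∧ ∀ y ∈ closedBall x r, η y = 1 := by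
  let ψ : ContDiffBump (0 : E2) := ⟨1, 2, one_pos, one_lt_two⟩
  obtain ⟨D, hD⟩ := ContDiff.lipschitzWith_of_hasCompactSupport (n := 1)
    ψ.hasCompactSupport ψ.contDiff (by simp)
  refine ⟨D, fun x r hr => ?_⟩
  have hs : tsupport (fun y => ψ (r⁻¹ • (y - x))) ⊆ closedBall x (2 * r) := by
    refine closure_minimal (fun y hy => ?_) isClosed_closedBall
    have h1 : r⁻¹ • (y - x) ∈ ball (0 : E2) 2 := by
      have : r⁻¹ • (y - x) ∈ Function.support ψ := hy
      rwa [ψ.support_eq] at this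
    rw [mem_ball_zero_iff, norm_smul, ← dist_eq_norm, Real.norm_eq_abs,
      abs_of_pos (by positivity), inv_mul_lt_iff₀ hr, mul_comm] at h1
    exact h1.le
  refine ⟨fun y => ψ (r⁻¹ • (y - x)), ?_, ?_, ?_, hs, ?_, ?_⟩
  · have h : ContDiff ℝ ∞ fun y : E2 => r⁻¹ • (y - x) := by fun_prop
    exact ψ.contDiff.comp h
  · exact (isCompact_closedBall x (2 * r)).of_isClosed_subset (isClosed_tsupport _) hs
  · refine hD.comp (LipschitzWith.of_dist_le_mul fun y z => ?_)
    rw [dist_smul₀, dist_sub_right, Real.coe_toNNReal _ (by positivity), Real.norm_eq_abs,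
      abs_of_pos (by positivity)]
  · exact fun y => ψ.nonneg
  · intro y hy
    refine ψ.one_of_mem_closedBall ?_
    rw [mem_closedBall_zero_iff, norm_smul, ← dist_eq_norm, Real.norm_eq_abs,
      abs_of_pos (by positivity)]
    show r⁻¹ * dist y x ≤ 1
    rw [inv_mul_le_iff₀ hr, mul_one]
    exact hy

/-- Variation bound for the gradient of a concave function that oscillates little on a ball. -/
lemma exists_variation_bound : ∃ K : ℝ, 0 < K ∧ ∀ {w : E2 → ℝ} {C : ℝ≥0},
    ConcaveOn ℝ univ w → LipschitzWith C w → ∀ {x ν : E2} {r κ : ℝ}, 0 < r → 0 ≤ κ →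
    (∀ y ∈ closedBall x (2 * r), DifferentiableAt ℝ w y → ‖gradient w y - ν‖ ≤ κ) →
    ∀ {φ : Fin 2 → E2 → E2}, (∀ i, ContDiff ℝ ∞ (φ i)) → (∀ i, HasCompactSupport (φ i)) →
    (∀ i, tsupport (φ i) ⊆ closedBall x r) → (∀ x, (∑ i : Fin 2, ‖φ i x‖ ^ 2) ≤ 1) →
    ∑ i : Fin 2, ∫ x, gradient w x i * divg (φ i) x ≤ K * κ * r := by
  obtain ⟨D, hD⟩ := exists_smooth_cutoff
  refine ⟨16 * D * Real.pi + 1, by positivity, ?_⟩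
  intro w C hw hwL x ν r κ hr hκ0 hκ φ hφ hφc hφs hφ1
  obtain ⟨η, hη, hηc, hηL, hηs, hη0, hη1⟩ := hD x r hr
  have hφη : ∀ i y j, |φ i y j| ≤ η y := by
    intro i y j
    by_cases hy : y ∈ closedBall x r
    · rw [hη1 y hy]
      have h1 : |φ i y j| ≤ ‖φ i y‖ := PiLp.norm_apply_le (φ i y) j
      have h2 : ‖φ i y‖ ^ 2 ≤ 1 :=
        (Finset.single_le_sum (f := fun i => ‖φ i y‖ ^ 2) (fun _ _ => by positivity)
          (Finset.mem_univ i)).trans (hφ1 y)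
      exact h1.trans ((sq_le_one_iff₀ (norm_nonneg _)).1 h2)
    · have : φ i y = 0 := image_eq_zero_of_notMem_tsupport fun h => hy (hφs i h)
      simpa [this] using hη0 y
  have h1 := hw.sum_integral_gradient_mul_divg_le hwL hφ hφc hη hηc hφη
  have h2 := neg_hessPairing_le_of_gradient_near hwL hη hηc hηL (by positivity) hηs hκ
  have h3 := h2 0
  have h4 := h2 1
  rw [Fin.sum_univ_two (f := fun i => - _)] at h1
  have hDr : ((D * r⁻¹.toNNReal : ℝ≥0) : ℝ) * (Real.pi * (2 * r) ^ 2) = 4 * D * Real.pi * r := by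
    rw [NNReal.coe_mul, Real.coe_toNNReal _ (by positivity)]
    field_simp
    ring
  rw [mul_assoc, hDr] at h3 h4
  have : 0 ≤ κ * r := by positivity
  nlinarith

lemma ConcaveOn.le_add_inner_gradient {w : E2 → ℝ} (hw : ConcaveOn ℝ univ w) {y : E2}
    (hy : DifferentiableAt ℝ w y) (z : E2) : w z ≤ w y + inner ℝ (gradient w y) (z - y) := by
  have h := (hy.hasFDerivAt.hasLineDerivAt (z - y)).tendsto_slope_zero_right
  rw [gradient, InnerProductSpace.toDual_symm_apply, ← sub_le_iff_le_add']
  refine ge_of_tendsto h ?_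
  filter_upwards [Ioc_mem_nhdsGT (zero_lt_one (α := ℝ))] with t ht
  have h1 := hw.2 (mem_univ y) (mem_univ z) (sub_nonneg.2 ht.2) ht.1.le (by ring)
  have h2 : (1 - t) • y + t • z = y + t • (z - y) := by module
  rw [h2] at h1
  simp only [smul_eq_mul] at h1 ⊢
  rw [inv_mul_eq_div, le_div_iff₀ ht.1]
  nlinarith

/-- A concave function on a convex set that is `1`-Lipschitz extends to a concave `1`-Lipschitz
function on the whole space. -/
lemma exists_concave_lipschitz_extension {s : Set E2} (hs : s.Nonempty) {f : E2 → ℝ}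
    (hf : ConcaveOn ℝ s f) (hfL : LipschitzWith 1 f) :
    ∃ w : E2 → ℝ, ConcaveOn ℝ univ w ∧ LipschitzWith 1 w ∧ EqOn w f s := by
  have : Nonempty s := hs.to_subtype
  have hle : ∀ x z : E2, f z - dist x z ≤ f x := fun x z => by
    have h := hfL.dist_le_mul z x
    rw [Real.dist_eq, NNReal.coe_one, one_mul, dist_comm z x] at h
    linarith [le_abs_self (f z - f x)]
  have hbdd : ∀ x : E2, BddAbove (range fun z : s => f z - dist x (z : E2)) := fun x =>
    ⟨f x, by rintro _ ⟨z, rfl⟩; exact hle x z⟩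
  refine ⟨fun x => ⨆ z : s, (f z - dist x z), ⟨convex_univ, ?_⟩, ?_, ?_⟩
  · intro x _ y _ a b ha hb hab
    refine le_of_forall_pos_le_add fun ε hε => ?_
    obtain ⟨z, hz⟩ := exists_lt_of_lt_ciSup
      (sub_lt_self (⨆ z : s, (f z - dist x z)) hε)
    obtain ⟨z', hz'⟩ := exists_lt_of_lt_ciSup
      (sub_lt_self (⨆ z : s, (f z - dist y z)) hε)
    have hmem : a • (z : E2) + b • (z' : E2) ∈ s := hf.1 z.2 z'.2 ha hb hab
    have h1 := le_ciSup (hbdd (a • x + b • y)) ⟨_, hmem⟩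
    have h2 := hf.2 z.2 z'.2 ha hb hab
    have h3 : dist (a • x + b • y) (a • (z : E2) + b • (z' : E2)) ≤
        a * dist x z + b * dist y z' := by
      refine (dist_add_add_le _ _ _ _).trans ?_
      rw [dist_smul₀, dist_smul₀, Real.norm_of_nonneg ha, Real.norm_of_nonneg hb]
    simp only [smul_eq_mul] at h2 ⊢
    have h4 := mul_le_mul_of_nonneg_left hz.le ha
    have h5 := mul_le_mul_of_nonneg_left hz'.le hb
    have h6 : a * ε + b * ε = ε := by rw [← add_mul, hab, one_mul]
    linarith
  · refine LipschitzWith.of_le_add fun x y => ciSup_le fun z => ?_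
    have := le_ciSup (hbdd y) z
    linarith [dist_triangle y x z, dist_comm x y]
  · intro x hx
    refine le_antisymm (ciSup_le fun z => hle x z) ?_
    simpa using le_ciSup (hbdd x) ⟨x, hx⟩

section ConvexBody

variable {Ω : Set E2}

lemma ball_infDist_frontier_subset {x : E2} (hx : x ∈ Ω) :
    ball x (infDist x (frontier Ω)) ⊆ Ω := by
  rcases le_or_gt (infDist x (frontier Ω)) 0 with h | h
  · simp [ball_eq_empty.2 h]
  refine ((convex_ball x (infDist x (frontier Ω))).isPreconnected.subset_left_of_subset_union
    isOpen_interior (isClosed_closure (s := Ω)).isOpen_compl ?_ (fun y hy => ?_)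
    ⟨x, mem_ball_self h, ?_⟩).trans interior_subset
  · exact disjoint_compl_right_iff_subset.2 (interior_subset.trans subset_closure)
  · by_contra hcon
    simp only [mem_union, mem_compl_iff, not_or, not_not] at hcon
    exact ball_infDist_subset_compl hy ⟨hcon.2, hcon.1⟩
  · by_contra hcon
    exact ball_infDist_subset_compl (mem_ball_self h) ⟨subset_closure hx, hcon⟩

lemma IsCompact.frontier_nonempty (hΩ : IsCompact Ω) (hne : Ω.Nonempty) :
    (frontier Ω).Nonempty :=
  nonempty_frontier_iff.2 ⟨hne, hΩ.ne_univ⟩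

lemma IsCompact.le_infDist_frontier (hΩ : IsCompact Ω) (hne : Ω.Nonempty) {x : E2} {r : ℝ}
    (h : ball x r ⊆ Ω) : r ≤ infDist x (frontier Ω) := by
  refine (le_infDist (hΩ.frontier_nonempty hne)).2 fun y hy => ?_
  by_contra! hcon
  exact hy.2 (interior_maximal h isOpen_ball (mem_ball'.2 hcon))

lemma IsCompact.concaveOn_infDist_frontier (hΩ : IsCompact Ω) (hne : Ω.Nonempty)
    (hc : Convex ℝ Ω) : ConcaveOn ℝ Ω fun x => infDist x (frontier Ω) := by
  refine ⟨hc, fun x hx y hy a b ha hb hab => hΩ.le_infDist_frontier hne fun z hz => ?_⟩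
  simp only [smul_eq_mul] at hz
  set p := infDist x (frontier Ω) with hp
  set q := infDist y (frontier Ω) with hq
  have hpos : 0 < a * p + b * q := dist_nonneg.trans_lt hz
  set e : E2 := (a * p + b * q)⁻¹ • (z - (a • x + b • y)) with he
  have hen : ‖e‖ < 1 := by
    rw [he, norm_smul, norm_inv, Real.norm_of_nonneg hpos.le, inv_mul_lt_iff₀ hpos, mul_one,
      ← dist_eq_norm]
    exact hz
  have hze : z = a • (x + p • e) + b • (y + q • e) := by
    have h1 : (a * p + b * q) • e = z - (a • x + b • y) := by
      rw [he, smul_inv_smul₀ hpos.ne']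
    have h2 : z = (a * p + b * q) • e + (a • x + b • y) := by rw [h1]; abel
    rw [h2]
    module
  have hmem : ∀ u ∈ Ω, u + infDist u (frontier Ω) • e ∈ Ω := fun u hu => by
    rcases infDist_nonneg.eq_or_lt (a := (0 : ℝ)) (b := infDist u (frontier Ω)) with h | h
    · simpa [← h] using hu
    · refine ball_infDist_frontier_subset hu ?_
      rw [mem_ball, dist_self_add_left, norm_smul, Real.norm_of_nonneg h.le]
      exact mul_lt_of_lt_one_right h hen
  rw [hze]
  exact hc (hmem x hx) (hmem y hy) ha hb hab

/-- Only balls of radius at most `√(β / π)` fit in a set of measure at most `β`. -/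
lemma pi_mul_sq_le_of_ball_subset_symmDiff (hΩ : IsCompact Ω) {β : ℝ}
    (hβ : (volume (symmDiff Ω (ball (0 : E2) 1))).toReal ≤ β) {x : E2} {r : ℝ} (hr : 0 ≤ r)
    (h : ball x r ⊆ symmDiff Ω (ball (0 : E2) 1)) : Real.pi * r ^ 2 ≤ β := by
  have hfin : volume (symmDiff Ω (ball (0 : E2) 1)) ≠ ⊤ := by
    refine ne_top_of_le_ne_top (measure_union_lt_top hΩ.measure_lt_top measure_ball_lt_top).ne
      (measure_mono (t := Ω ∪ ball (0 : E2) 1) ?_)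
    exact symmDiff_le_sup
  have h1 := ENNReal.toReal_mono hfin (measure_mono h)
  rw [EuclideanSpace.volume_ball_fin_two] at h1
  simp only [ENNReal.toReal_mul, ENNReal.toReal_pow, ENNReal.toReal_ofReal hr,
    ENNReal.toReal_ofReal Real.pi_pos.le] at h1
  linarith

lemma ball_subset_of_volume_symmDiff_le (hΩ : IsCompact Ω) (hne : Ω.Nonempty)
    (hc : Convex ℝ Ω) {δ : ℝ} (hδ : 0 < δ)
    (hβ : (volume (symmDiff Ω (ball (0 : E2) 1))).toReal ≤ δ ^ 2) :
    ball 0 (1 - 2 * δ) ⊆ Ω := by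
  intro q hq
  by_contra hqΩ
  obtain ⟨f, u, hfu, huf⟩ := geometric_hahn_banach_closed_point hc hΩ.isClosed hqΩ
  rw [mem_ball_zero_iff] at hq
  have hδ1 : 0 < 1 - 2 * δ := (norm_nonneg q).trans_lt hq
  set m : E2 := (InnerProductSpace.toDual ℝ E2).symm f with hm
  have hfm : ∀ x, f x = inner ℝ m x := fun x => by rw [hm, InnerProductSpace.toDual_symm_apply]
  have hm0 : 0 < ‖m‖ := by
    rw [norm_pos_iff]
    intro h0
    obtain ⟨a, ha⟩ := hne
    have h1 := hfu a ha
    rw [hfm, h0, inner_zero_left] at h1 huf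
    exact lt_asymm h1 huf
  have hsub : ball ((1 - δ) • (‖m‖⁻¹ • m)) δ ⊆ symmDiff Ω (ball (0 : E2) 1) := by
    intro y hy
    rw [mem_ball, dist_eq_norm] at hy
    have hv : ‖(1 - δ) • (‖m‖⁻¹ • m)‖ = 1 - δ := by
      rw [norm_smul, norm_smul, norm_inv, norm_norm, inv_mul_cancel₀ hm0.ne', mul_one,
        Real.norm_of_nonneg (by linarith)]
    have hmv : inner ℝ m ((1 - δ) • (‖m‖⁻¹ • m)) = (1 - δ) * ‖m‖ := by
      rw [inner_smul_right, inner_smul_right, real_inner_self_eq_norm_mul_norm,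
        inv_mul_cancel_left₀ hm0.ne']
    refine Or.inr ⟨?_, fun hyΩ => ?_⟩
    · rw [mem_ball_zero_iff]
      linarith [norm_sub_norm_le y ((1 - δ) • (‖m‖⁻¹ • m))]
    · have h1 := hfu y hyΩ
      rw [hfm] at h1 huf
      have h2 := neg_le_of_abs_le (abs_real_inner_le_norm m (y - (1 - δ) • (‖m‖⁻¹ • m)))
      rw [inner_sub_right, hmv] at h2
      have h3 := real_inner_le_norm m q
      have h4 := mul_lt_mul_of_pos_left hy hm0
      have h5 := mul_lt_mul_of_pos_left hq hm0
      linarith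
  have h := pi_mul_sq_le_of_ball_subset_symmDiff hΩ hβ hδ.le hsub
  nlinarith [Real.pi_gt_three, pow_pos hδ 2]

lemma subset_closedBall_of_volume_symmDiff_le (hΩ : IsCompact Ω) (hc : Convex ℝ Ω) {δ : ℝ}
    (hδ : 0 < δ) (hδ1 : δ ≤ 1 / 16)
    (hβ : (volume (symmDiff Ω (ball (0 : E2) 1))).toReal ≤ δ ^ 2) :
    Ω ⊆ closedBall 0 (1 + 8 * δ) := by
  intro z hz
  by_contra hcon
  rw [mem_closedBall_zero_iff, not_le] at hcon
  have hin := ball_subset_of_volume_symmDiff_le hΩ ⟨z, hz⟩ hc hδ hβ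
  have hsub : ball ((1 - 2 * δ) • z) (2 * δ * (1 - 2 * δ)) ⊆ symmDiff Ω (ball (0 : E2) 1) := by
    intro y hy
    rw [mem_ball, dist_eq_norm] at hy
    refine Or.inl ⟨?_, ?_⟩
    · have hb : (2 * δ)⁻¹ • (y - (1 - 2 * δ) • z) ∈ Ω := by
        refine hin ?_
        rw [mem_ball_zero_iff, norm_smul, norm_inv, Real.norm_of_nonneg (by positivity),
          inv_mul_lt_iff₀ (by positivity)]
        exact hy
      have h := hc hz hb (a := 1 - 2 * δ) (b := 2 * δ) (by linarith) (by linarith) (by ring)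
      rwa [smul_inv_smul₀ (by positivity), add_sub_cancel] at h
    · rw [mem_ball_zero_iff, not_lt]
      have h1 : ‖(1 - 2 * δ) • z‖ = (1 - 2 * δ) * ‖z‖ := by
        rw [norm_smul, Real.norm_of_nonneg (by linarith)]
      have h2 := norm_sub_norm_le ((1 - 2 * δ) • z) y
      rw [norm_sub_rev, h1] at h2
      nlinarith
  have h := pi_mul_sq_le_of_ball_subset_symmDiff hΩ hβ (by nlinarith) hsub
  have h3 : δ ≤ 2 * δ * (1 - 2 * δ) := by nlinarith
  have h4 : δ ^ 2 ≤ (2 * δ * (1 - 2 * δ)) ^ 2 := pow_le_pow_left₀ hδ.le h3 2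
  nlinarith [Real.pi_gt_three, pow_pos hδ 2]

lemma infDist_frontier_add_norm_le {R : ℝ} (hR : Ω ⊆ closedBall 0 R) {x : E2} (hx : x ∈ Ω)
    (hx0 : x ≠ 0) : infDist x (frontier Ω) + ‖x‖ ≤ R := by
  have hxn : 0 < ‖x‖ := norm_pos_iff.2 hx0
  have hxR : ‖x‖ ≤ R := mem_closedBall_zero_iff.1 (hR hx)
  by_contra! hcon
  set d := infDist x (frontier Ω) with hd
  set r := (d + R - ‖x‖) / 2 with hr
  have hr0 : 0 ≤ r := by linarith
  have hy : x + (r / ‖x‖) • x ∈ ball x d := by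
    rw [mem_ball, dist_self_add_left, norm_smul, norm_div, norm_norm, div_mul_cancel₀ _ hxn.ne',
      Real.norm_of_nonneg hr0]
    linarith
  have h1 := mem_closedBall_zero_iff.1 (hR (ball_infDist_frontier_subset hx hy))
  have h2 : x + (r / ‖x‖) • x = (1 + r / ‖x‖) • x := by module
  rw [h2, norm_smul, Real.norm_of_nonneg (by positivity), add_mul, one_mul,
    div_mul_cancel₀ _ hxn.ne'] at h1
  linarith

/-- The restriction of the variation of `∇ d(·, ∂Ω)` to a subset of `Ω` can be computed from any
extension of the distance function. -/
lemma totalVar_gradient_infDist_frontier_le (hc : Convex ℝ Ω) {w : E2 → ℝ}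
    (hw : EqOn w (fun x => infDist x (frontier Ω)) Ω) {A : Set E2} (hA : A ⊆ Ω) {c : ℝ}
    (hc0 : 0 ≤ c)
    (hφ : ∀ φ : Fin 2 → E2 → E2, (∀ i, ContDiff ℝ ∞ (φ i)) → (∀ i, HasCompactSupport (φ i)) →
      (∀ i, tsupport (φ i) ⊆ A) → (∀ x, (∑ i : Fin 2, ‖φ i x‖ ^ 2) ≤ 1) →
      ∑ i : Fin 2, ∫ x, gradient w x i * divg (φ i) x ≤ c) :
    totalVar (gradient fun x => infDist x (frontier Ω)) A ≤ c := by
  refine Real.sSup_le ?_ hc0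
  rintro t ⟨φ, h1, h2, h3, h4, rfl⟩
  refine le_of_eq_of_le (Finset.sum_congr rfl fun i _ => ?_) (hφ φ h1 h2 h3 h4)
  have hdiv : ∀ x, x ∉ A → divg (φ i) x = 0 := fun x hx => by
    have : fderiv ℝ (φ i) x = 0 := fderiv_of_notMem_tsupport (𝕜 := ℝ) fun h => hx (h3 i h)
    simp [divg, this]
  rw [setIntegral_eq_integral_of_forall_compl_eq_zero fun x hx => by rw [hdiv x hx, mul_zero]]
  refine integral_congr_ae ?_
  filter_upwards [measure_eq_zero_iff_ae_notMem.1 (hc.addHaar_frontier volume)] with x hx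
  by_cases hxA : x ∈ A
  · have hint : x ∈ interior Ω := by
      by_contra hcon
      exact hx ⟨subset_closure (hA hxA), hcon⟩
    have heq : w =ᶠ[𝓝 x] fun x => infDist x (frontier Ω) :=
      hw.eventuallyEq_of_mem (mem_interior_iff_mem_nhds.1 hint)
    simp only [gradient, heq.fderiv_eq]
  · simp [hdiv x hxA]

end ConvexBody

lemma norm_gradient_le_of_lipschitzWith {w : E2 → ℝ} {C : ℝ≥0} (hw : LipschitzWith C w) (y : E2) :
    ‖gradient w y‖ ≤ C := by
  rw [gradient, LinearIsometryEquiv.norm_map]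
  exact norm_fderiv_le_of_lipschitz ℝ hw

/-- A concave `1`-Lipschitz function that nearly attains the slope `-1` between `0` and `x` has
gradient close to `-x / ‖x‖` near `x`. -/
lemma ConcaveOn.norm_gradient_add_sq_le {w : E2 → ℝ} (hw : ConcaveOn ℝ univ w)
    (hwL : LipschitzWith 1 w) {x y : E2} (hx : x ≠ 0) {ε : ℝ} (h : w x + ‖x‖ ≤ w 0 + ε)
    (hy : DifferentiableAt ℝ w y) :
    ‖gradient w y - (-(‖x‖⁻¹ • x))‖ ^ 2 ≤ 2 * (ε + 2 * dist y x) / ‖x‖ := by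
  have hxn : 0 < ‖x‖ := norm_pos_iff.2 hx
  have hg : ‖gradient w y‖ ≤ 1 := norm_gradient_le_of_lipschitzWith hwL y
  have h1 := hw.le_add_inner_gradient hy 0
  have h2 : w y ≤ w x + dist y x := by
    have := hwL.dist_le_mul y x
    rw [Real.dist_eq, NNReal.coe_one, one_mul] at this
    linarith [le_abs_self (w y - w x)]
  have h3 : inner ℝ (gradient w y) (0 - y) ≤ - inner ℝ (gradient w y) x + dist y x := by
    have h4 : (0 : E2) - y = - x + (x - y) := by abel
    rw [h4, inner_add_right, inner_neg_right]
    have h5 := real_inner_le_norm (gradient w y) (x - y)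
    rw [← dist_eq_norm, dist_comm] at h5
    nlinarith [dist_nonneg (x := y) (y := x)]
  have h6 : ‖x‖ + inner ℝ (gradient w y) x ≤ ε + 2 * dist y x := by linarith
  rw [sub_neg_eq_add, norm_add_sq_real, inner_smul_right, norm_smul, norm_inv, norm_norm,
    inv_mul_cancel₀ hxn.ne', le_div_iff₀ hxn]
  have h7 : ‖gradient w y‖ ^ 2 ≤ 1 := (sq_le_one_iff₀ (norm_nonneg _)).2 hg
  have h8 : (‖x‖⁻¹ * inner ℝ (gradient w y) x) * ‖x‖ = inner ℝ (gradient w y) x := by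
    field_simp
  nlinarith

/-- Lemma `LL12` of the paper: total variation bounds for `∇u`,
`u = d(·, ∂Ω)`, on a convex body `β`-close to the unit ball. -/
theorem statement14 :
    ∃ c : ℝ, 0 < c ∧ ∃ β₀ : ℝ, 0 < β₀ ∧
      ∀ (β : ℝ) (Ω : Set E2), 0 < β → β ≤ β₀ →
        Convex ℝ Ω → IsCompact Ω → (interior Ω).Nonempty →
        (volume (symmDiff Ω (ball (0 : E2) 1))).toReal ≤ β →
        totalVar (gradient fun x => Metric.infDist x (frontier Ω))
            (Ω \ ball (0 : E2) (3 * β ^ ((1 : ℝ) / 8))) ≤ c ∧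
        ∀ ϱ : ℝ, 0 < ϱ → ϱ ≤ Real.sqrt β →
          ∀ x ∈ Ω \ (Metric.thickening (2 * ϱ) (frontier Ω) ∪
              ball (0 : E2) (4 * β ^ ((1 : ℝ) / 8))),
            totalVar (gradient fun y => Metric.infDist y (frontier Ω)) (ball x ϱ) ≤
              c * β ^ ((3 : ℝ) / 16) * ϱ := by
  obtain ⟨K, hK0, hK⟩ := exists_variation_bound
  refine ⟨3 * K, by positivity, (1 / 16) ^ 16, by positivity, ?_⟩
  intro β Ω hβ0 hβ hc hΩ hint hvol
  have hne : Ω.Nonempty := hint.mono interior_subset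
  obtain ⟨t, ht0, rfl⟩ : ∃ t : ℝ, 0 < t ∧ t ^ 16 = β :=
    ⟨β ^ ((1 : ℝ) / 16), by positivity, by
      rw [← Real.rpow_natCast, ← Real.rpow_mul hβ0.le]; norm_num⟩
  have ht1 : t ≤ 1 / 16 := le_of_pow_le_pow_left₀ (by norm_num) (by norm_num) hβ
  have hroot : ∀ k : ℕ, (t ^ 16) ^ ((k : ℝ) / 16) = t ^ k := fun k => by
    rw [← Real.rpow_natCast t 16, ← Real.rpow_mul ht0.le, ← Real.rpow_natCast t k]
    congr 1
    push_cast
    ring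
  have hr2 : (t ^ 16) ^ ((1 : ℝ) / 8) = t ^ 2 := by
    rw [← hroot 2]; norm_num
  have hr3 : (t ^ 16) ^ ((3 : ℝ) / 16) = t ^ 3 := by
    rw [← hroot 3]; norm_num
  have hsqrt : Real.sqrt (t ^ 16) = t ^ 8 := by
    rw [show t ^ 16 = (t ^ 8) ^ 2 by ring, Real.sqrt_sq (by positivity)]
  rw [hr2, hr3, hsqrt]
  have hδ0 : 0 < t ^ 8 := by positivity
  have hδ1 : t ^ 8 ≤ 1 / 16 :=
    (pow_le_of_le_one ht0.le (by linarith) (by norm_num)).trans ht1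
  have hvol' : (volume (symmDiff Ω (ball (0 : E2) 1))).toReal ≤ (t ^ 8) ^ 2 := by
    rwa [← pow_mul]
  have hin := ball_subset_of_volume_symmDiff_le hΩ hne hc hδ0 hvol'
  have hout := subset_closedBall_of_volume_symmDiff_le hΩ hc hδ0 hδ1 hvol'
  obtain ⟨w, hw, hwL, hwΩ⟩ := exists_concave_lipschitz_extension hne
    (hΩ.concaveOn_infDist_frontier hne hc) (lipschitz_infDist_pt _)
  refine ⟨?_, fun ϱ hϱ0 hϱ x hx => ?_⟩
  · refine totalVar_gradient_infDist_frontier_le hc hwΩ sdiff_subset (by positivity)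
      fun φ h1 h2 h3 h4 => ?_
    have hsub : closedBall (0 : E2) (1 + 8 * t ^ 8) ⊆ closedBall 0 (3 / 2) :=
      closedBall_subset_closedBall (by linarith)
    refine (hK hw hwL (x := 0) (ν := 0) (r := 3 / 2) (κ := 1) (by norm_num) zero_le_one
      (fun y _ _ => ?_) h1 h2 (fun i => ((h3 i).trans sdiff_subset).trans (hout.trans hsub))
      h4).trans (by linarith)
    rw [sub_zero]
    exact norm_gradient_le_of_lipschitzWith hwL y
  · obtain ⟨hxΩ, hx'⟩ := hx
    rw [mem_union, not_or, mem_ball_zero_iff, not_lt] at hx'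
    obtain ⟨hxf, hxn⟩ := hx'
    have hx0 : x ≠ 0 := norm_pos_iff.1 (lt_of_lt_of_le (by positivity) hxn)
    have hd : 2 * ϱ ≤ infDist x (frontier Ω) := by
      rwa [mem_thickening_iff_infDist_lt (hΩ.frontier_nonempty hne), not_lt] at hxf
    have hball : ball x ϱ ⊆ Ω :=
      (ball_subset_ball (by linarith)).trans (ball_infDist_frontier_subset hxΩ)
    have hzero : (0 : E2) ∈ Ω := hin (mem_ball_self (by linarith))
    have h0 : 1 - 2 * t ^ 8 ≤ w 0 := by
      rw [hwΩ hzero]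
      exact hΩ.le_infDist_frontier hne hin
    have hslope : w x + ‖x‖ ≤ w 0 + 10 * t ^ 8 := by
      rw [hwΩ hxΩ]
      linarith [infDist_frontier_add_norm_le hout hxΩ hx0]
    refine totalVar_gradient_infDist_frontier_le hc hwΩ hball (by positivity)
      fun φ h1 h2 h3 h4 => ?_
    refine (hK hw hwL (x := x) (ν := -(‖x‖⁻¹ • x)) (r := ϱ) (κ := 3 * t ^ 3) hϱ0 (by positivity)
      (fun y hy hdy => ?_) h1 h2 (fun i => (h3 i).trans ball_subset_closedBall) h4).trans
      (by linarith)
    rw [← sq_le_sq₀ (norm_nonneg _) (by positivity)]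
    refine (hw.norm_gradient_add_sq_le hwL hx0 hslope hdy).trans ?_
    rw [div_le_iff₀ (norm_pos_iff.2 hx0)]
    rw [mem_closedBall] at hy
    calc 2 * (10 * t ^ 8 + 2 * dist y x) ≤ 28 * t ^ 8 := by linarith
      _ ≤ (3 * t ^ 3) ^ 2 * (4 * t ^ 2) := by nlinarith
      _ ≤ (3 * t ^ 3) ^ 2 * ‖x‖ := by gcongr
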